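/- Let p ∈ (2,3]. Let R₀, C₀, M, M', δ > 0, α, β with β ∈ ℂ ∖ {0}, and let ω₀ : ℝ² → ℝ be smooth with compact support. Let K be a compact subset of B(0,R₀), U = ℝ² ∖ K, and let T : U → {z ∈ ℂ : |z| > 1} ∪ {z : |z| = 1} be an injective holomorphic map of U onto {z ∈ ℂ : |z| > 1} with |T(z)| ≥ 1 on U, of the form T(z) = βz + h(z) with h : U → ℂ bounded holomorphic and sup_U |h| ≤ M; assume |DT(x)| ≤ C₀ for |x| ≥ R₀, ‖DT‖_{L³(U ∩ B(0,R₀))} ≤ M, |det D(T⁻¹)(z)| ≤ M' for all |z| > 1, supp ω₀ ⊂ U ∩ B(0,R₀), and |T(y)| ≥ 1 + δ for all y ∈ supp ω₀. Define u₀(x) = K_T[ω₀](x) + α H_T(x) for x ∈ U, extended by 0 on K. Then ‖u₀‖_{L^p(ℝ²)} ≤ C, where C depends only on p, α, β, C₀, R₀, M, M', δ, sup|ω₀| and the support of ω₀ (and not otherwise on T or K). -/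

import Mathlib

open MeasureTheory Metric Set Filter

noncomputable section

/-- counterclockwise rotation of a vector of ℝ² ≃ ℂ by a right angle: `(x₁,x₂) ↦ (-x₂,x₁)` -/
def perp (v : ℂ) : ℂ := Complex.I * v

/-- the real (euclidean) dot product on ℝ² ≃ ℂ -/
def dotR (a b : ℂ) : ℝ := a.re * b.re + a.im * b.im

/-- the transpose of a real-linear map of ℝ² ≃ ℂ, applied to a vector `w` -/
def transApply (L : ℂ →L[ℝ] ℂ) (w : ℂ) : ℂ :=
  (dotR (L 1) w : ℂ) + (dotR (L Complex.I) w : ℂ) * Complex.I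

/-- the harmonic vector field `H_T(x) = (1/2π) DT(x)^T (T(x)^⊥ / |T(x)|²)` -/
def HT (T : ℂ → ℂ) (x : ℂ) : ℂ :=
  (1 / (2 * Real.pi)) • transApply (fderiv ℝ T x) ((‖T x‖ ^ 2)⁻¹ • perp (T x))

/-- `T(y)* = T(y)/|T(y)|²` -/
def starT (T : ℂ → ℂ) (y : ℂ) : ℂ := (‖T y‖ ^ 2)⁻¹ • T y

/-- the Biot–Savart-type operator
`K_T[ω](x) = (1/2π) DT(x)^T ∫ ((T(x)−T(y))^⊥/|T(x)−T(y)|² − (T(x)−T(y)*)^⊥/|T(x)−T(y)*|²) ω(y) dy` -/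
def KT (T : ℂ → ℂ) (ω : ℂ → ℝ) (x : ℂ) : ℂ :=
  (1 / (2 * Real.pi)) • transApply (fderiv ℝ T x)
    (∫ y : ℂ, ω y • ((‖T x - T y‖ ^ 2)⁻¹ • perp (T x - T y)
      - (‖T x - starT T y‖ ^ 2)⁻¹ • perp (T x - starT T y)))

theorem norm_inv_sq_smul_perp (v : ℂ) : ‖(‖v‖ ^ 2)⁻¹ • perp v‖ = ‖v‖⁻¹ := by
  rcases eq_or_ne v 0 with rfl | hv
  · simp [perp]
  · have : ‖v‖ ≠ 0 := norm_ne_zero_iff.mpr hv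
    rw [norm_smul, perp, norm_mul, Complex.norm_I, one_mul, norm_inv, norm_pow, norm_norm]
    field_simp

theorem abs_dotR_le (a b : ℂ) : |dotR a b| ≤ ‖a‖ * ‖b‖ := by
  have h : dotR a b = inner ℝ a b := by
    rw [Complex.inner]
    simp [dotR, mul_comm]
  rw [h]
  exact abs_real_inner_le_norm a b

theorem norm_transApply_le (L : ℂ →L[ℝ] ℂ) (w : ℂ) : ‖transApply L w‖ ≤ 2 * ‖L‖ * ‖w‖ := by
  have h1 : ‖L 1‖ ≤ ‖L‖ := by simpa using L.le_opNorm 1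
  have h2 : ‖L Complex.I‖ ≤ ‖L‖ := by simpa using L.le_opNorm Complex.I
  calc ‖transApply L w‖ ≤ |dotR (L 1) w| + |dotR (L Complex.I) w| := by
        refine (norm_add_le _ _).trans (le_of_eq ?_)
        simp [Complex.norm_real]
    _ ≤ ‖L‖ * ‖w‖ + ‖L‖ * ‖w‖ := by
        gcongr
        · exact (abs_dotR_le _ _).trans (by gcongr)
        · exact (abs_dotR_le _ _).trans (by gcongr)
    _ = 2 * ‖L‖ * ‖w‖ := by ring

/-- The kernel `1/|z|` is integrable over the planar unit disc. -/
theorem lintegral_ball_inv_norm_lt_top :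
    ∫⁻ z in ball (0 : ℂ) 1, ENNReal.ofReal ‖z‖⁻¹ < ⊤ := by
  have h : IntegrableOn (fun z : ℂ => ‖z‖⁻¹) (ball 0 1) := by
    refine integrableOn_ball_of_norm_le_rpow (α := 1) (C := 1) (by simp) (by simp)
      (ae_of_all _ fun z => ?_) (by fun_prop)
    simp [Real.rpow_neg_one]
  exact h.lintegral_lt_top

/-- Splitting the integral of `1/|a - z|` at distance one from the pole. -/
theorem setLIntegral_inv_norm_sub_le (a : ℂ) (s : Set ℂ) :
    ∫⁻ z in s, ENNReal.ofReal ‖a - z‖⁻¹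
      ≤ (∫⁻ z in ball (0 : ℂ) 1, ENNReal.ofReal ‖z‖⁻¹) + volume s := by
  have hsplit (z : ℂ) : ENNReal.ofReal ‖a - z‖⁻¹
      ≤ (ball (0 : ℂ) 1).indicator (fun z => ENNReal.ofReal ‖z‖⁻¹) (a - z) + 1 := by
    by_cases hz : a - z ∈ ball (0 : ℂ) 1
    · rw [indicator_of_mem hz]
      exact le_self_add
    · rw [indicator_of_notMem hz, zero_add, ← ENNReal.ofReal_one]
      exact ENNReal.ofReal_le_ofReal (inv_le_one_of_one_le₀ (by simpa using hz))
  calc ∫⁻ z in s, ENNReal.ofReal ‖a - z‖⁻¹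
      ≤ ∫⁻ z in s, ((ball (0 : ℂ) 1).indicator (fun z => ENNReal.ofReal ‖z‖⁻¹) (a - z) + 1) :=
        lintegral_mono hsplit
    _ = (∫⁻ z in s, (ball (0 : ℂ) 1).indicator (fun z => ENNReal.ofReal ‖z‖⁻¹) (a - z))
          + volume s := by
        rw [lintegral_add_right _ measurable_const]
        simp
    _ ≤ (∫⁻ z, (ball (0 : ℂ) 1).indicator (fun z => ENNReal.ofReal ‖z‖⁻¹) (a - z))
          + volume s := by
        gcongr
        exact Measure.restrict_le_self
    _ = _ := by
        rw [lintegral_sub_left_eq_self, lintegral_indicator measurableSet_ball]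

/-- The derivative of an injective holomorphic function is almost everywhere nonzero. -/
theorem ae_deriv_ne_zero_of_injOn {U : Set ℂ} {T : ℂ → ℂ} (hU : IsOpen U)
    (hT : DifferentiableOn ℂ T U) (hinj : InjOn T U) :
    ∀ᵐ y ∂volume.restrict U, deriv T y ≠ 0 := by
  refine ae_restrict_le_codiscreteWithin hU.measurableSet ?_
  change {y | deriv T y ≠ 0} ∈ codiscreteWithin U
  rw [mem_codiscreteWithin_iff_forall_mem_nhdsNE]
  intro y hy
  rcases ((hT.deriv hU).analyticAt (hU.mem_nhds hy)).eventually_eq_zero_or_eventually_ne_zero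
    with h | h
  · exfalso
    obtain ⟨r, hr, hball⟩ := Metric.eventually_nhds_iff_ball.mp (h.and (hU.eventually_mem hy))
    have hy' : y + (r / 2 : ℝ) ∈ ball y r := by
      simp [abs_of_pos hr, hr]
    have hconst : T (y + (r / 2 : ℝ)) = T y := by
      refine isOpen_ball.is_const_of_deriv_eq_zero (convex_ball y r).isPreconnected
        (hT.mono fun z hz => (hball z hz).2) (fun z hz => (hball z hz).1) hy' (mem_ball_self hr)
    have := hinj (hball _ hy').2 hy hconst
    simp [hr.ne'] at this
  · filter_upwards [h] with z hz using Or.inl hz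

/-- A right inverse of an injective holomorphic map is a differentiable inverse near noncritical
values, so the two Jacobian determinants are reciprocal. -/
theorem det_fderiv_mul_det_fderiv_eq_one {U : Set ℂ} {T S : ℂ → ℂ} (hU : IsOpen U)
    (hT : DifferentiableOn ℂ T U) {y : ℂ} (hy : y ∈ U) (hdT : deriv T y ≠ 0)
    (hS : ∀ᶠ z in nhds y, S (T z) = z) :
    (fderiv ℝ S (T y)).det * (fderiv ℝ T y).det = 1 := by
  have hTs : HasStrictDerivAt T (deriv T y) y :=
    (hT.analyticAt (hU.mem_nhds hy)).hasStrictDerivAt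
  have hSd := ((hTs.to_local_left_inverse hdT hS).hasDerivAt.differentiableAt.restrictScalars
    ℝ).hasFDerivAt
  have hTd := (hTs.hasDerivAt.differentiableAt.restrictScalars ℝ).hasFDerivAt
  have hid : HasFDerivAt (S ∘ T) (ContinuousLinearMap.id ℝ ℂ) y :=
    (hasFDerivAt_id y).congr_of_eventuallyEq hS
  have hcomp := (hSd.comp y hTd).unique hid
  calc (fderiv ℝ S (T y)).det * (fderiv ℝ T y).det
      = ((fderiv ℝ S (T y)).comp (fderiv ℝ T y)).det := (LinearMap.det_comp _ _).symm
    _ = 1 := by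
      rw [hcomp]
      exact LinearMap.det_id

/-- Pulling back `∫ g` through an injective map whose Jacobian is bounded below. -/
theorem setLIntegral_comp_le_of_jacobian {V : Set ℂ} {T : ℂ → ℂ} {M' : ℝ} (hV : MeasurableSet V)
    (hM' : 0 ≤ M') (hT : ∀ y ∈ V, DifferentiableAt ℝ T y) (hinj : InjOn T V)
    (hdet : ∀ᵐ y ∂volume.restrict V, 1 ≤ M' * |(fderiv ℝ T y).det|) (g : ℂ → ENNReal) :
    ∫⁻ y in V, g (T y) ≤ ENNReal.ofReal M' * ∫⁻ z in T '' V, g z := by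
  rw [lintegral_image_eq_lintegral_abs_det_fderiv_mul volume hV
    (fun y hy => (hT y hy).hasFDerivAt.hasFDerivWithinAt) hinj,
    ← lintegral_const_mul' _ _ ENNReal.ofReal_ne_top]
  refine lintegral_mono_ae ?_
  filter_upwards [hdet] with y hy
  rw [← mul_assoc, ← ENNReal.ofReal_mul hM']
  calc g (T y) = 1 * g (T y) := (one_mul _).symm
    _ ≤ _ := by
      gcongr
      rw [← ENNReal.ofReal_one]
      exact ENNReal.ofReal_le_ofReal hy

/-- The Biot–Savart integral of the exterior domain, as a function of the image point `a = T x`. -/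
def kernelIntegral (T : ℂ → ℂ) (ω : ℂ → ℝ) (a : ℂ) : ℂ :=
  ∫ y : ℂ, ω y • ((‖a - T y‖ ^ 2)⁻¹ • perp (a - T y)
    - (‖a - starT T y‖ ^ 2)⁻¹ • perp (a - starT T y))

theorem norm_KT_le (T : ℂ → ℂ) (ω : ℂ → ℝ) (x : ℂ) :
    ‖KT T ω x‖ ≤ ‖fderiv ℝ T x‖ * ‖kernelIntegral T ω (T x)‖ := by
  have hπ : 0 < Real.pi := Real.pi_pos
  calc ‖KT T ω x‖
      = (1 / (2 * Real.pi)) * ‖transApply (fderiv ℝ T x) (kernelIntegral T ω (T x))‖ := by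
        rw [KT, norm_smul, Real.norm_of_nonneg (by positivity)]
        rfl
    _ ≤ (1 / (2 * 1)) * (2 * ‖fderiv ℝ T x‖ * ‖kernelIntegral T ω (T x)‖) := by
        gcongr
        · linarith [Real.pi_gt_three]
        · exact norm_transApply_le _ _
    _ = _ := by ring

theorem norm_HT_le (T : ℂ → ℂ) (x : ℂ) : ‖HT T x‖ ≤ ‖fderiv ℝ T x‖ * ‖T x‖⁻¹ := by
  have hπ : 0 < Real.pi := Real.pi_pos
  calc ‖HT T x‖ = (1 / (2 * Real.pi)) *
        ‖transApply (fderiv ℝ T x) ((‖T x‖ ^ 2)⁻¹ • perp (T x))‖ := by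
        rw [HT, norm_smul, Real.norm_of_nonneg (by positivity)]
    _ ≤ (1 / (2 * 1)) * (2 * ‖fderiv ℝ T x‖ * ‖T x‖⁻¹) := by
        gcongr
        · linarith [Real.pi_gt_three]
        · rw [← norm_inv_sq_smul_perp (T x)]
          exact norm_transApply_le _ _
    _ = _ := by ring

theorem norm_starT (T : ℂ → ℂ) (y : ℂ) : ‖starT T y‖ = ‖T y‖⁻¹ := by
  rcases eq_or_ne (T y) 0 with hy | hy
  · simp [starT, hy]
  · have : ‖T y‖ ≠ 0 := norm_ne_zero_iff.mpr hy
    rw [starT, norm_smul, norm_inv, norm_pow, norm_norm]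
    field_simp

/-- Absolute-value bound for the Biot–Savart integral when the reflected kernel is bounded. -/
theorem enorm_kernelIntegral_le {T : ℂ → ℂ} {ω : ℂ → ℝ} {a : ℂ} {m b : ℝ} (hm : 0 ≤ m)
    (hω : ∀ y, ‖ω y‖ ≤ m) (hb : ∀ y ∈ tsupport ω, ‖a - starT T y‖⁻¹ ≤ b) :
    ‖kernelIntegral T ω a‖ₑ ≤ ENNReal.ofReal m *
      ((∫⁻ y in tsupport ω, ENNReal.ofReal ‖a - T y‖⁻¹)
        + ENNReal.ofReal b * volume (tsupport ω)) := by
  have hpt (y : ℂ) : ‖ω y • ((‖a - T y‖ ^ 2)⁻¹ • perp (a - T y)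
      - (‖a - starT T y‖ ^ 2)⁻¹ • perp (a - starT T y))‖ₑ ≤ (tsupport ω).indicator
        (fun y => ENNReal.ofReal m * (ENNReal.ofReal ‖a - T y‖⁻¹ + ENNReal.ofReal b)) y := by
    by_cases hy : y ∈ tsupport ω
    · rw [indicator_of_mem hy, ← ofReal_norm,
        ← ENNReal.ofReal_add (by positivity) ((by positivity : (0 : ℝ) ≤ _).trans (hb y hy)),
        ← ENNReal.ofReal_mul hm]
      apply ENNReal.ofReal_le_ofReal
      rw [norm_smul]
      gcongr
      · exact hω y
      · refine (norm_sub_le _ _).trans ?_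
        rw [norm_inv_sq_smul_perp, norm_inv_sq_smul_perp]
        gcongr
        exact hb y hy
    · simp [image_eq_zero_of_notMem_tsupport hy]
  calc ‖kernelIntegral T ω a‖ₑ ≤ _ := enorm_integral_le_lintegral_enorm _
    _ ≤ _ := lintegral_mono hpt
    _ = _ := by
      rw [lintegral_indicator (isClosed_tsupport ω).measurableSet,
        lintegral_const_mul' _ _ ENNReal.ofReal_ne_top, lintegral_add_right _ measurable_const]
      simp

/-- A bounded quantity decaying like `1/(b r)` beyond `b r = L` is `O(1/(1 + r))`. -/
theorem mul_one_add_le_of_decay {n r W b L D : ℝ} (hn : 0 ≤ n) (hr : 0 ≤ r) (hb : 0 < b)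
    (hL : 0 ≤ L) (hD : 0 ≤ D) (hnW : n ≤ W) (hdecay : L ≤ b * r → n * (b * r) ≤ D) :
    n * (1 + r) ≤ W + (W * L + D) / b := by
  have hW : 0 ≤ W := hn.trans hnW
  have key : n * (b * r) ≤ W * L + D := by
    rcases le_total L (b * r) with h | h
    · have := hdecay h
      have := mul_nonneg hW hL
      linarith
    · have := mul_le_mul hnW h (by positivity) hW
      linarith
  have : n * r ≤ (W * L + D) / b := by
    rw [le_div_iff₀ hb]
    linarith
  linarith

/-- Uniform boundedness and decay of the Biot–Savart integral. -/
theorem exists_kernelIntegral_bound {R₀ M M' δ : ℝ} {β : ℂ} (hR₀ : 0 < R₀) (hM : 0 < M)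
    (hM' : 0 < M') (hδ : 0 < δ) (hβ : β ≠ 0) {ω : ℂ → ℝ} (hω : Continuous ω)
    (hωc : HasCompactSupport ω) :
    ∃ E : ℝ, 0 ≤ E ∧ ∀ (U : Set ℂ) (T S : ℂ → ℂ), IsOpen U → InjOn T U →
      DifferentiableOn ℂ T U → (∀ z ∈ U, 1 ≤ ‖T z‖) → (∀ z ∈ U, ‖T z - β * z‖ ≤ M) →
      (∀ z : ℂ, 1 < ‖z‖ → S z ∈ U ∧ T (S z) = z) →
      (∀ z : ℂ, 1 < ‖z‖ → |(fderiv ℝ S z).det| ≤ M') →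
      tsupport ω ⊆ U ∩ ball 0 R₀ → (∀ y ∈ tsupport ω, 1 + δ ≤ ‖T y‖) →
      ∀ x ∈ U, ‖kernelIntegral T ω (T x)‖ * (1 + ‖x‖) ≤ E := by
  obtain ⟨m₀, hm₀⟩ := hωc.exists_bound_of_continuous hω
  have hm : 0 ≤ m₀ := (norm_nonneg _).trans (hm₀ 0)
  have hvol : volume (tsupport ω) ≠ ⊤ := hωc.isCompact.measure_ne_top
  have hb : 0 < ‖β‖ := norm_pos_iff.mpr hβ
  set ρ : ℝ := ‖β‖ * R₀ + M with hρ
  have hρ0 : 0 < ρ := by positivity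
  set J : ENNReal := ∫⁻ z in ball (0 : ℂ) 1, ENNReal.ofReal ‖z‖⁻¹ with hJ
  set B : ENNReal := ENNReal.ofReal m₀ *
    (ENNReal.ofReal M' * (J + volume (closedBall (0 : ℂ) ρ))
      + ENNReal.ofReal ((1 + δ) / δ) * volume (tsupport ω)) with hB
  have hBtop : B ≠ ⊤ := by
    have h1 : J ≠ ⊤ := lintegral_ball_inv_norm_lt_top.ne
    have h2 : volume (closedBall (0 : ℂ) ρ) ≠ ⊤ := measure_closedBall_lt_top.ne
    finiteness
  set v : ℝ := (volume (tsupport ω)).toReal with hv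
  set L : ℝ := 2 * (ρ + M + 1) with hL
  refine ⟨B.toReal + (B.toReal * L + 4 * m₀ * v) / ‖β‖, by positivity, ?_⟩
  intro U T S hU hinj hT hT1 hTβ hS hdet hsupp hTδ x hx
  have hV : MeasurableSet (tsupport ω) := (isClosed_tsupport ω).measurableSet
  have hVU : tsupport ω ⊆ U := fun y hy => (hsupp hy).1
  have hTy : ∀ y ∈ tsupport ω, ‖T y‖ ≤ ρ := by
    intro y hy
    have h1 : ‖y‖ < R₀ := by simpa using (hsupp hy).2
    calc ‖T y‖ = ‖β * y + (T y - β * y)‖ := by ring_nf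
      _ ≤ ‖β * y‖ + ‖T y - β * y‖ := norm_add_le _ _
      _ ≤ ‖β‖ * R₀ + M := by
        rw [norm_mul]
        gcongr
        exact hTβ y (hVU hy)
  have hstar : ∀ y ∈ tsupport ω, ‖starT T y‖ ≤ (1 + δ)⁻¹ := by
    intro y hy
    rw [norm_starT]
    gcongr
    exact hTδ y hy
  apply mul_one_add_le_of_decay (norm_nonneg _) (norm_nonneg _) hb (by positivity)
    (by positivity)
  · have hjac : ∀ᵐ y ∂volume.restrict (tsupport ω), 1 ≤ M' * |(fderiv ℝ T y).det| := by
      filter_upwards [ae_restrict_of_ae_restrict_of_subset hVU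
        (ae_deriv_ne_zero_of_injOn hU hT hinj), ae_restrict_mem hV] with y hy hyV
      have hyT : 1 < ‖T y‖ := by linarith [hTδ y hyV]
      have hST : ∀ᶠ z in nhds y, S (T z) = z := by
        have hcont : ContinuousAt (fun z => ‖T z‖) y :=
          (hT.continuousOn.continuousAt (hU.mem_nhds (hVU hyV))).norm
        filter_upwards [hcont.eventually (lt_mem_nhds hyT), hU.mem_nhds (hVU hyV)] with z hz hzU
        exact hinj (hS _ hz).1 hzU (hS _ hz).2
      have hprod := det_fderiv_mul_det_fderiv_eq_one hU hT (hVU hyV) hy hST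
      calc (1 : ℝ) = |(fderiv ℝ S (T y)).det| * |(fderiv ℝ T y).det| := by
            rw [← abs_mul, hprod, abs_one]
        _ ≤ _ := by
          gcongr
          exact hdet _ hyT
    have hmain : ‖kernelIntegral T ω (T x)‖ₑ ≤ B := by
      refine (enorm_kernelIntegral_le (b := (1 + δ) / δ) hm hm₀ fun y hy => ?_).trans ?_
      · have h1 : 1 - (1 + δ)⁻¹ ≤ ‖T x - starT T y‖ := by
          have := norm_sub_norm_le (T x) (starT T y)
          linarith [hT1 x hx, hstar y hy]
        have h2 : 1 - (1 + δ)⁻¹ = δ / (1 + δ) := by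
          field_simp
          ring
        rw [← inv_div, ← h2]
        gcongr
        rw [h2]
        positivity
      · rw [hB]
        gcongr
        refine (setLIntegral_comp_le_of_jacobian hV hM'.le (fun y hy =>
          (hT.differentiableAt (hU.mem_nhds (hVU hy))).restrictScalars ℝ) (hinj.mono hVU) hjac
          (fun z => ENNReal.ofReal ‖T x - z‖⁻¹)).trans ?_
        gcongr
        refine (setLIntegral_inv_norm_sub_le _ _).trans ?_
        gcongr
        rintro _ ⟨y, hy, rfl⟩
        simpa using hTy y hy
    rw [← toReal_enorm]
    exact ENNReal.toReal_mono hBtop hmain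
  · intro hfar
    have hTx : ‖β‖ * ‖x‖ - M ≤ ‖T x‖ := by
      have h1 : ‖β * x‖ ≤ ‖T x‖ + ‖T x - β * x‖ := by
        have := norm_sub_le (T x) (T x - β * x)
        rwa [sub_sub_cancel] at this
      rw [norm_mul] at h1
      linarith [hTβ x hx]
    have hpos : 0 < ‖β‖ * ‖x‖ := lt_of_lt_of_le (by positivity) hfar
    have hker : ∀ z : ℂ, ‖z‖ ≤ ρ + 1 → ‖T x - z‖⁻¹ ≤ 2 / (‖β‖ * ‖x‖) := by
      intro z hz
      have h1 : ‖β‖ * ‖x‖ / 2 ≤ ‖T x - z‖ := by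
        have := norm_sub_norm_le (T x) z
        linarith
      rw [← inv_div]
      gcongr
    have hmain : ‖kernelIntegral T ω (T x)‖ₑ ≤
        ENNReal.ofReal (m₀ * (2 / (‖β‖ * ‖x‖) * v + 2 / (‖β‖ * ‖x‖) * v)) := by
      refine (enorm_kernelIntegral_le (b := 2 / (‖β‖ * ‖x‖)) hm hm₀ fun y hy => ?_).trans ?_
      · refine hker _ ((hstar y hy).trans ?_)
        have : (1 + δ)⁻¹ ≤ 1 := inv_le_one_of_one_le₀ (by linarith)
        linarith
      · rw [ENNReal.ofReal_mul hm, ENNReal.ofReal_add (by positivity) (by positivity),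
          ENNReal.ofReal_mul (by positivity), hv, ENNReal.ofReal_toReal hvol]
        gcongr
        refine (setLIntegral_mono' hV fun y hy => ENNReal.ofReal_le_ofReal
          (hker (T y) ((hTy y hy).trans (by linarith)))).trans ?_
        simp
    have hle : ‖kernelIntegral T ω (T x)‖ ≤ m₀ * (2 / (‖β‖ * ‖x‖) * v + 2 / (‖β‖ * ‖x‖) * v) := by
      rw [← ofReal_norm] at hmain
      exact (ENNReal.ofReal_le_ofReal_iff (by positivity)).mp hmain
    calc _ ≤ m₀ * (2 / (‖β‖ * ‖x‖) * v + 2 / (‖β‖ * ‖x‖) * v) * (‖β‖ * ‖x‖) := by gcongr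
      _ = 4 * m₀ * v := by
        generalize ‖β‖ * ‖x‖ = r at hpos
        field_simp
        ring

/-- Decay of the modulus of the harmonic field factor `1/|T|`. -/
theorem inv_norm_mul_one_add_le {M : ℝ} {β a x : ℂ} (hM : 0 < M) (hβ : β ≠ 0) (ha : 1 ≤ ‖a‖)
    (hax : ‖a - β * x‖ ≤ M) : ‖a‖⁻¹ * (1 + ‖x‖) ≤ 1 + (1 * (2 * M) + 2) / ‖β‖ := by
  apply mul_one_add_le_of_decay (by positivity) (norm_nonneg _) (norm_pos_iff.mpr hβ)
    (by positivity) (by positivity) (inv_le_one_of_one_le₀ ha)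
  intro hfar
  have h1 : ‖β * x‖ ≤ ‖a‖ + ‖a - β * x‖ := by
    have := norm_sub_le a (a - β * x)
    rwa [sub_sub_cancel] at this
  rw [norm_mul] at h1
  rw [inv_mul_le_iff₀ (by positivity)]
  linarith

theorem eLpNorm_one_add_norm_inv_lt_top {p : ℝ} (hp : 2 < p) :
    eLpNorm (fun x : ℂ => (1 + ‖x‖)⁻¹) (ENNReal.ofReal p) volume < ⊤ := by
  have hp0 : 0 < p := by linarith
  have hint : Integrable (fun x : ℂ => (1 + ‖x‖) ^ (-p)) :=
    integrable_one_add_norm (by simpa using hp)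
  rw [eLpNorm_lt_top_iff_lintegral_rpow_enorm_lt_top (by simpa using hp0) ENNReal.ofReal_ne_top,
    ENNReal.toReal_ofReal hp0.le]
  refine lt_of_le_of_lt (lintegral_mono fun x => le_of_eq ?_) hint.lintegral_lt_top
  rw [Real.enorm_of_nonneg (by positivity), ENNReal.ofReal_rpow_of_nonneg (by positivity) hp0.le,
    Real.inv_rpow (by positivity), Real.rpow_neg (by positivity)]

/-- Hölder's inequality on a subset of a ball. -/
theorem eLpNorm_indicator_norm_le {F : Type*} [NormedAddCommGroup F] {f : ℂ → F} {U : Set ℂ}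
    {R p A M : ℝ} (hA : 0 ≤ A) (hp0 : 0 < p) (hp3 : p ≤ 3) (hU : MeasurableSet U)
    (hf : AEStronglyMeasurable f (volume.restrict (U ∩ ball 0 R)))
    (hfM : eLpNorm f 3 (volume.restrict (U ∩ ball 0 R)) ≤ ENNReal.ofReal M) :
    eLpNorm ((U ∩ ball 0 R).indicator fun x => A * ‖f x‖) (ENNReal.ofReal p) volume
      ≤ ENNReal.ofReal A * (ENNReal.ofReal M * volume (ball (0 : ℂ) R) ^ (1 / p - 1 / 3)) := by
  rw [eLpNorm_indicator_eq_eLpNorm_restrict (hU.inter measurableSet_ball)]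
  have hp : ENNReal.ofReal p ≤ 3 := by
    simpa using ENNReal.ofReal_le_ofReal hp3
  have hexp : 0 ≤ 1 / p - 1 / 3 := sub_nonneg.mpr (one_div_le_one_div_of_le hp0 hp3)
  calc eLpNorm (fun x => A * ‖f x‖) (ENNReal.ofReal p) (volume.restrict (U ∩ ball 0 R))
      ≤ ENNReal.ofReal A * eLpNorm f (ENNReal.ofReal p) (volume.restrict (U ∩ ball 0 R)) :=
        eLpNorm_le_mul_eLpNorm_of_ae_le_mul (ae_of_all _ fun x => by
          simp [abs_of_nonneg hA]) _
    _ ≤ ENNReal.ofReal A * (eLpNorm f 3 (volume.restrict (U ∩ ball 0 R)) *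
          (volume.restrict (U ∩ ball 0 R)) univ ^
            (1 / (ENNReal.ofReal p).toReal - 1 / (3 : ENNReal).toReal)) := by
        gcongr
        exact eLpNorm_le_eLpNorm_mul_rpow_measure_univ hp hf
    _ ≤ _ := by
        rw [ENNReal.toReal_ofReal hp0.le, ENNReal.toReal_ofNat, Measure.restrict_apply_univ]
        gcongr
        exact inter_subset_right

/-- Uniform `L^p` bound, `2 < p ≤ 3`, for the initial velocity
`u₀ = K_T[ω₀] + α H_T` (extended by `0` on `K`), with a constant depending only on
`p, α, β, C₀, R₀, M, M', δ` and `ω₀` (and not otherwise on `T` or `K`). -/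
theorem initial_velocity_Lp_bound
    (p : ℝ) (hp2 : 2 < p) (hp3 : p ≤ 3)
    (R₀ C₀ M M' δ α : ℝ) (β : ℂ)
    (hR₀ : 0 < R₀) (hC₀ : 0 < C₀) (hM : 0 < M) (hM' : 0 < M') (hδ : 0 < δ)
    (hβ : β ≠ 0)
    (ω₀ : ℂ → ℝ) (hω : ContDiff ℝ (⊤ : ℕ∞) ω₀) (hωc : HasCompactSupport ω₀) :
    ∃ C : ℝ, 0 < C ∧
      ∀ (K : Set ℂ) (T h S : ℂ → ℂ),
        IsCompact K → K ⊆ Metric.ball 0 R₀ →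
        Set.InjOn T Kᶜ →
        DifferentiableOn ℂ T Kᶜ →
        Set.SurjOn T Kᶜ {z : ℂ | 1 < ‖z‖} →
        (∀ z ∈ Kᶜ, 1 ≤ ‖T z‖) →
        DifferentiableOn ℂ h Kᶜ →
        (∀ z ∈ Kᶜ, ‖h z‖ ≤ M) →
        (∀ z ∈ Kᶜ, T z = β * z + h z) →
        (∀ x ∈ Kᶜ, R₀ ≤ ‖x‖ → ‖fderiv ℝ T x‖ ≤ C₀) →
        eLpNorm (fun x => fderiv ℝ T x) 3 (volume.restrict (Kᶜ ∩ Metric.ball 0 R₀))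
          ≤ ENNReal.ofReal M →
        (∀ z : ℂ, 1 < ‖z‖ → S z ∈ Kᶜ ∧ T (S z) = z) →
        (∀ z : ℂ, 1 < ‖z‖ → |LinearMap.det ((fderiv ℝ S z : ℂ →ₗ[ℝ] ℂ))| ≤ M') →
        tsupport ω₀ ⊆ Kᶜ ∩ Metric.ball 0 R₀ →
        (∀ y ∈ tsupport ω₀, 1 + δ ≤ ‖T y‖) →
        ∀ u₀ : ℂ → ℂ,
          (∀ x ∈ Kᶜ, u₀ x = KT T ω₀ x + α • HT T x) →
          (∀ x ∈ K, u₀ x = 0) →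
          eLpNorm u₀ (ENNReal.ofReal p) volume ≤ ENNReal.ofReal C := by
  obtain ⟨E, hE, hkernel⟩ := exists_kernelIntegral_bound hR₀ hM hM' hδ hβ hω.continuous hωc
  set E' : ℝ := 1 + (1 * (2 * M) + 2) / ‖β‖
  have hE' : 0 ≤ E' := by positivity
  set A : ℝ := E + |α| * E' with hAdef
  have hA : 0 ≤ A := by positivity
  have hp0 : 0 < p := by linarith
  set B : ENNReal := ENNReal.ofReal A *
      (ENNReal.ofReal M * volume (ball (0 : ℂ) R₀) ^ (1 / p - 1 / 3))
    + ENNReal.ofReal (A * C₀) * eLpNorm (fun x : ℂ => (1 + ‖x‖)⁻¹) (ENNReal.ofReal p) volume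
    with hB
  have hBtop : B ≠ ⊤ := by
    have h1 := (eLpNorm_one_add_norm_inv_lt_top hp2).ne
    have h2 : volume (ball (0 : ℂ) R₀) ^ (1 / p - 1 / 3) ≠ ⊤ :=
      ENNReal.rpow_ne_top_of_nonneg (sub_nonneg.mpr (one_div_le_one_div_of_le hp0 hp3))
        measure_ball_lt_top.ne
    finiteness
  refine ⟨B.toReal + 1, by positivity, ?_⟩
  intro K T h S hK _ hinj hT _ hT1 _ hhM hTh hfar hL3 hS hdet hsupp hTδ u₀ hu hu0
  have hU : IsOpen Kᶜ := hK.isClosed.isOpen_compl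
  have hTβ : ∀ z ∈ Kᶜ, ‖T z - β * z‖ ≤ M := fun z hz => by
    rw [hTh z hz, add_sub_cancel_left]
    exact hhM z hz
  have hpt : ∀ x ∈ Kᶜ, ‖u₀ x‖ ≤ A * ‖fderiv ℝ T x‖ * (1 + ‖x‖)⁻¹ := by
    intro x hx
    have h1 := hkernel Kᶜ T S hU hinj hT hT1 hTβ hS hdet hsupp hTδ x hx
    have h2 := inv_norm_mul_one_add_le hM hβ (hT1 x hx) (hTβ x hx)
    rw [← div_eq_mul_inv, le_div_iff₀ (by positivity), hu x hx]
    calc ‖KT T ω₀ x + α • HT T x‖ * (1 + ‖x‖)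
        ≤ (‖fderiv ℝ T x‖ * ‖kernelIntegral T ω₀ (T x)‖
            + |α| * (‖fderiv ℝ T x‖ * ‖T x‖⁻¹)) * (1 + ‖x‖) := by
          gcongr
          refine (norm_add_le _ _).trans (add_le_add (norm_KT_le _ _ _) ?_)
          rw [norm_smul, Real.norm_eq_abs]
          gcongr
          exact norm_HT_le _ _
      _ = ‖fderiv ℝ T x‖ * (‖kernelIntegral T ω₀ (T x)‖ * (1 + ‖x‖)
            + |α| * (‖T x‖⁻¹ * (1 + ‖x‖))) := by ring
      _ ≤ ‖fderiv ℝ T x‖ * (E + |α| * E') := by gcongr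
      _ = A * ‖fderiv ℝ T x‖ := mul_comm _ _
  set f₁ : ℂ → ℝ := (Kᶜ ∩ ball 0 R₀).indicator fun x => A * ‖fderiv ℝ T x‖ with hf₁
  set f₂ : ℂ → ℝ := fun x => A * C₀ * (1 + ‖x‖)⁻¹ with hf₂
  have hf₁0 (x : ℂ) : 0 ≤ f₁ x := indicator_nonneg (fun _ _ => by positivity) x
  have hf₂0 (x : ℂ) : 0 ≤ f₂ x := by positivity
  have hbound (x : ℂ) : ‖u₀ x‖ ≤ (f₁ + f₂) x := by
    rw [Pi.add_apply]
    by_cases hx : x ∈ K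
    · rw [hu0 x hx, norm_zero]
      exact add_nonneg (hf₁0 x) (hf₂0 x)
    · by_cases hxR : x ∈ ball (0 : ℂ) R₀
      · have h1 : f₁ x = A * ‖fderiv ℝ T x‖ :=
          indicator_of_mem (show x ∈ Kᶜ ∩ ball 0 R₀ from ⟨hx, hxR⟩) _
        have h2 : (1 + ‖x‖)⁻¹ ≤ 1 := inv_le_one_of_one_le₀ (by linarith [norm_nonneg x])
        calc ‖u₀ x‖ ≤ A * ‖fderiv ℝ T x‖ * (1 + ‖x‖)⁻¹ := hpt x hx
          _ ≤ A * ‖fderiv ℝ T x‖ := mul_le_of_le_one_right (by positivity) h2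
          _ ≤ f₁ x + f₂ x := by linarith [hf₂0 x]
      · have h1 : ‖fderiv ℝ T x‖ ≤ C₀ := hfar x hx (by simpa using hxR)
        calc ‖u₀ x‖ ≤ A * ‖fderiv ℝ T x‖ * (1 + ‖x‖)⁻¹ := hpt x hx
          _ ≤ A * C₀ * (1 + ‖x‖)⁻¹ := by gcongr
          _ ≤ f₁ x + f₂ x := le_add_of_nonneg_left (hf₁0 x)
  have hmeas : Measurable (fderiv ℝ T) := measurable_fderiv ℝ T
  have hm₁ : AEStronglyMeasurable f₁ volume :=
    ((hmeas.norm.const_mul A).indicator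
      (hU.measurableSet.inter measurableSet_ball)).aestronglyMeasurable
  have hm₂ : AEStronglyMeasurable f₂ volume := by
    have : Measurable f₂ := by fun_prop
    exact this.aestronglyMeasurable
  have hone : 1 ≤ ENNReal.ofReal p := by
    rw [← ENNReal.ofReal_one]
    exact ENNReal.ofReal_le_ofReal (by linarith)
  calc eLpNorm u₀ (ENNReal.ofReal p) volume
      ≤ eLpNorm (f₁ + f₂) (ENNReal.ofReal p) volume := eLpNorm_mono_real hbound
    _ ≤ eLpNorm f₁ (ENNReal.ofReal p) volume + eLpNorm f₂ (ENNReal.ofReal p) volume :=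
        eLpNorm_add_le hm₁ hm₂ hone
    _ ≤ B := by
        refine add_le_add (eLpNorm_indicator_norm_le hA hp0 hp3 hU.measurableSet
          hmeas.aestronglyMeasurable hL3) (eLpNorm_le_mul_eLpNorm_of_ae_le_mul
            (ae_of_all _ fun x => ?_) _)
        rw [Real.norm_of_nonneg (hf₂0 x), Real.norm_of_nonneg (by positivity)]
    _ = ENNReal.ofReal B.toReal := (ENNReal.ofReal_toReal hBtop).symm
    _ ≤ ENNReal.ofReal (B.toReal + 1) := ENNReal.ofReal_le_ofReal (by linarith)

end
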